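/- arXiv:1012.2381 — 2 statements merged into one kernel-verified Lean document; each statement's English description precedes it below -/
import Mathlib

section
/- Let Θ be a countably infinite ω-categorical structure with countable relational signature, and let R be an m-ary relation on the domain of Θ. Then R has a primitive positive definition in Θ if and only if every polymorphism of Θ preserves R. -/
open FirstOrder FirstOrder.Language

namespace PaperDef

/-- The structure `M` is *ordered*: some binary relation symbol of the signature
denotes a linear order on the domain. -/
def Ordered (L : Language) (M : Type*) [L.Structure M] : Prop :=
  ∃ r : L.Relations 2, IsLinearOrder M (fun a b => Structure.RelMap r ![a, b])

/-- A class of structures is a *Ramsey class*. -/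
def RamseyClass {L : Language} (K : Set (CategoryTheory.Bundled.{0} L.Structure)) : Prop :=
  ∀ k : ℕ, 1 ≤ k → ∀ H ∈ K, ∀ P ∈ K, ∃ S ∈ K,
    ∀ χ : {Q : L.Substructure S // Nonempty (P ≃[L] Q)} → Fin k,
      ∃ e : H ↪[L] S,
        ∀ Q₁ Q₂ : {Q : L.Substructure S // Nonempty (P ≃[L] Q)},
          (Q₁.1 : Set S) ⊆ Set.range e → (Q₂.1 : Set S) ⊆ Set.range e → χ Q₁ = χ Q₂

/-- `M` is *finitely bounded*: membership of a finite(ly generated) structure in the age of `M`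
is characterized by finitely many forbidden substructures. -/
def FinitelyBounded (L : Language) (M : Type) [L.Structure M] : Prop :=
  ∃ (k : ℕ) (F : Fin k → CategoryTheory.Bundled.{0} L.Structure),
    (∀ i, Structure.FG L (F i)) ∧
    ∀ A : CategoryTheory.Bundled.{0} L.Structure, Structure.FG L A →
      (A ∈ L.age M ↔ ∀ i, ¬ Nonempty ((F i) ↪[L] A))

/-- The `L'`-structure on `M` is a *reduct* of the `L`-structure on `M`:
every relation of the former is first-order definable in the latter. -/
def IsReduct (L L' : Language) (M : Type*) [L.Structure M] [L'.Structure M] : Prop :=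
  ∀ (n : ℕ) (r : L'.Relations n), ∃ φ : L.Formula (Fin n),
    ∀ x : Fin n → M, Structure.RelMap r x ↔ φ.Realize x

/-- Two `n`-tuples have the same (complete first-order) type. -/
def SameType (L : Language) (M : Type*) [L.Structure M] {n : ℕ} (a b : Fin n → M) : Prop :=
  ∀ φ : L.Formula (Fin n), φ.Realize a ↔ φ.Realize b

/-- A function is *canonical*: it maps tuples of equal types to tuples of equal types. -/
def Canonical (L L' : Language) (X Ω : Type*) [L.Structure X] [L'.Structure Ω]
    (f : X → Ω) : Prop :=
  ∀ (n : ℕ) (a b : Fin n → X), SameType L X a b →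
    SameType L' Ω (fun i => f (a i)) (fun i => f (b i))

/-- A function is *canonical on a set `F`*. -/
def CanonicalOn (L L' : Language) (X Ω : Type*) [L.Structure X] [L'.Structure Ω]
    (F : Set X) (f : X → Ω) : Prop :=
  ∀ (n : ℕ) (a b : Fin n → X), (∀ i, a i ∈ F) → (∀ i, b i ∈ F) → SameType L X a b →
    SameType L' Ω (fun i => f (a i)) (fun i => f (b i))

/-- `M` is ω-categorical: every countable model of its complete theory is isomorphic to it. -/
def OmegaCategorical (L : Language) (M : Type) [L.Structure M] : Prop :=
  ∀ (N : Type) [L.Structure N], Countable N →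
    (∀ φ : L.Sentence, φ ∈ L.completeTheory M → N ⊨ φ) → Nonempty (M ≃[L] N)

/-- Primitive positive formulas: built from atomic formulas using `∧` and `∃`. -/
inductive IsPrimitivePositive {L : Language} {α : Type*} :
    ∀ {n : ℕ}, L.BoundedFormula α n → Prop
  | atomic {n : ℕ} {φ : L.BoundedFormula α n} (h : φ.IsAtomic) : IsPrimitivePositive φ
  | inf {n : ℕ} {φ ψ : L.BoundedFormula α n} :
      IsPrimitivePositive φ → IsPrimitivePositive ψ → IsPrimitivePositive (φ ⊓ ψ)
  | ex {n : ℕ} {φ : L.BoundedFormula α (n + 1)} :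
      IsPrimitivePositive φ → IsPrimitivePositive φ.ex

/-- Existential formulas: existentially quantified quantifier-free formulas. -/
inductive IsExistential {L : Language} {α : Type*} :
    ∀ {n : ℕ}, L.BoundedFormula α n → Prop
  | of_isQF {n : ℕ} {φ : L.BoundedFormula α n} (h : φ.IsQF) : IsExistential φ
  | ex {n : ℕ} {φ : L.BoundedFormula α (n + 1)} : IsExistential φ → IsExistential φ.ex

/-- Existential positive formulas: built from atomic formulas using `∧`, `∨` and `∃`. -/
inductive IsExistentialPositive {L : Language} {α : Type*} :
    ∀ {n : ℕ}, L.BoundedFormula α n → Prop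
  | atomic {n : ℕ} {φ : L.BoundedFormula α n} (h : φ.IsAtomic) : IsExistentialPositive φ
  | inf {n : ℕ} {φ ψ : L.BoundedFormula α n} :
      IsExistentialPositive φ → IsExistentialPositive ψ → IsExistentialPositive (φ ⊓ ψ)
  | sup {n : ℕ} {φ ψ : L.BoundedFormula α n} :
      IsExistentialPositive φ → IsExistentialPositive ψ → IsExistentialPositive (φ ⊔ ψ)
  | ex {n : ℕ} {φ : L.BoundedFormula α (n + 1)} :
      IsExistentialPositive φ → IsExistentialPositive φ.ex

/-- A `k`-ary operation *preserves* an `m`-ary relation. -/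
def Preserves {D : Type*} {k m : ℕ} (f : (Fin k → D) → D) (R : (Fin m → D) → Prop) : Prop :=
  ∀ rows : Fin k → Fin m → D, (∀ j, R (rows j)) → R (fun i => f (fun j => rows j i))

/-- A unary operation *preserves* an `m`-ary relation. -/
def Preserves1 {D : Type*} {m : ℕ} (f : D → D) (R : (Fin m → D) → Prop) : Prop :=
  ∀ a : Fin m → D, R a → R (fun i => f (a i))

/-- An endomorphism of the structure `M`. -/
def IsEndo (L : Language) (M : Type*) [L.Structure M] (f : M → M) : Prop :=
  ∀ (n : ℕ) (r : L.Relations n) (x : Fin n → M),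
    Structure.RelMap r x → Structure.RelMap r (fun i => f (x i))

/-- A self-embedding of the structure `M`. -/
def IsSelfEmb (L : Language) (M : Type*) [L.Structure M] (f : M → M) : Prop :=
  Function.Injective f ∧ ∀ (n : ℕ) (r : L.Relations n) (x : Fin n → M),
    (Structure.RelMap r (fun i => f (x i)) ↔ Structure.RelMap r x)

/-- A polymorphism of the structure `M`. -/
def IsPoly (L : Language) (M : Type*) [L.Structure M] {k : ℕ} (f : (Fin k → M) → M) : Prop :=
  ∀ (n : ℕ) (r : L.Relations n), Preserves f (fun x : Fin n → M => Structure.RelMap r x)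

/-- The set of endomorphisms of `M`. -/
def EndSet (L : Language) (M : Type*) [L.Structure M] : Set (M → M) :=
  {f | IsEndo L M f}

/-- Two tuples lie in the same orbit of the automorphism group. -/
def SameOrbit (L : Language) (M : Type*) [L.Structure M] {n : ℕ} (a b : Fin n → M) : Prop :=
  ∃ α : M ≃[L] M, ∀ i, α (a i) = b i

/-- The subsets `s` and `t` induce isomorphic substructures. -/
def SetIso (L : Language) (X : Type*) [L.Structure X] (s t : Set X) : Prop :=
  ∃ g : s ≃ t, ∀ (n : ℕ) (r : L.Relations n) (x : Fin n → s),
    (Structure.RelMap r (fun j => ((x j : X))) ↔ Structure.RelMap r (fun j => ((g (x j) : t) : X)))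

/-- The `L[[Fin n]]`-structure on `M` obtained by naming the constants `c 0, …, c (n-1)`. -/
def withConstantsStruct (L : Language) {M : Type*} [L.Structure M] {n : ℕ} (c : Fin n → M) :
    (L[[Fin n]]).Structure M :=
  letI := constantsOn.structure c
  inferInstance

/-- Two sequences of `n` tuples from a product `Ξ₁ × ⋯ × Ξₘ` have the same type:
componentwise, the corresponding `n`-tuples have the same type. -/
def SameSeqType {m : ℕ} (Ls : Fin m → Language) (Xs : Fin m → Type*)
    [∀ i, (Ls i).Structure (Xs i)] {n : ℕ} (a b : Fin n → ∀ i, Xs i) : Prop :=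
  ∀ i, SameType (Ls i) (Xs i) (fun j => a j i) (fun j => b j i)

/-- A function defined on a product of structures is canonical. -/
def CanonicalProd {m : ℕ} (Ls : Fin m → Language) (Xs : Fin m → Type*)
    [∀ i, (Ls i).Structure (Xs i)] (L' : Language) (Ω : Type*) [L'.Structure Ω]
    (f : (∀ i, Xs i) → Ω) : Prop :=
  ∀ (n : ℕ) (a b : Fin n → ∀ i, Xs i), SameSeqType Ls Xs a b →
    SameType L' Ω (fun j => f (a j)) (fun j => f (b j))

end PaperDef

namespace PaperDef

section RN
universe u v
variable {L : FirstOrder.Language.{u, v}} {M : Type} [L.Structure M]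

/-- The type of a tuple is isolated in `M` by a single formula. -/
def Iso {α : Type} (L : FirstOrder.Language.{u, v}) {M : Type} [L.Structure M] (a : α → M) : Prop :=
  ∃ θ : L.Formula α, θ.Realize a ∧
    ∀ b : α → M, θ.Realize b → ∀ ψ : L.Formula α, ψ.Realize a → ψ.Realize b

theorem card_le_aleph0 (hrel : ∀ i, IsEmpty (L.Functions i))
    (hcnt : Countable (Σ i, L.Relations i)) : L.card ≤ Cardinal.aleph0 := by
  have : Countable L.Symbols := inferInstance
  exact Cardinal.mk_le_aleph0_iff.2 this

/-- Compactness inside an ω-categorical structure. -/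
theorem realize_seq [Countable M] [Infinite M] (hL : L.card ≤ Cardinal.aleph0)
    (homega : OmegaCategorical L M) {α : Type} [Countable α] (φ : ℕ → L.Formula α)
    (h : ∀ n, ∃ w : α → M, ∀ i ≤ n, (φ i).Realize w) :
    ∃ w : α → M, ∀ i, (φ i).Realize w := by
  choose w hw using h
  let U : Ultrafilter ℕ := Filter.hyperfilter ℕ
  let P := (U : Filter ℕ).Product (fun _ => M)
  let x : α → ℕ → M := fun i n => w n i
  let y : α → P := fun i => (x i : (U : Filter ℕ).Product (fun _ => M))
  have hy : ∀ i, (φ i).Realize y := by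
    intro i
    refine (Ultraproduct.realize_formula_cast (M := fun _ => M) (u := U) (φ i) x).2 ?_
    have : ∀ᶠ n in Filter.atTop, (φ i).Realize (fun j => x j n) := by
      filter_upwards [Filter.eventually_ge_atTop i] with n hn
      exact hw n i hn
    have h2 : (U : Filter ℕ) ≤ Filter.atTop := by
      have := Filter.hyperfilter_le_cofinite (α := ℕ)
      rwa [Nat.cofinite_eq_atTop] at this
    exact h2 this
  have hth : ∀ ψ : L.Sentence, P ⊨ ψ ↔ M ⊨ ψ := by
    intro ψ
    refine (Ultraproduct.sentence_realize (M := fun _ => M) (u := U) ψ).trans ?_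
    simp
  have hinf : Infinite P := by
    have : M ≅[L] P := by
      rw [elementarilyEquivalent_iff]
      intro ψ; exact (hth ψ).symm
    exact this.infinite_iff.1 inferInstance
  obtain ⟨S, hS, hcard⟩ := exists_elementarySubstructure_card_eq L (M := P) (Set.range y)
    Cardinal.aleph0.{0} le_rfl
    (by
      have := Cardinal.mk_le_aleph0_iff.2 (Set.countable_range y).to_subtype
      simpa only [Cardinal.lift_id, Cardinal.lift_aleph0] using this)
    (by simpa using hL)
    (by simp)
  have hSc : Countable S := by
    rw [← Cardinal.mk_le_aleph0_iff]
    simpa using hcard.le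
  obtain ⟨e⟩ := homega S hSc (by
    intro ψ hψ
    rw [S.realize_sentence, hth]
    exact hψ)
  let z : α → S := fun i => ⟨y i, hS ⟨i, rfl⟩⟩
  refine ⟨fun i => e.symm (z i), fun i => ?_⟩
  have h1 : (φ i).Realize z := by
    rw [← S.subtype.map_formula]
    exact hy i
  exact (StrongHomClass.realize_formula e.symm (φ i)).2 h1

theorem iso_dense [Countable M] [Infinite M] (hL : L.card ≤ Cardinal.aleph0)
    (homega : OmegaCategorical L M) {α : Type} [Finite α] (φ : L.Formula α)
    (h : ∃ a : α → M, φ.Realize a) : ∃ a : α → M, φ.Realize a ∧ Iso L a := by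
  by_contra hcon
  push Not at hcon
  obtain ⟨e, he⟩ := exists_surjective_nat (α → M)
  let T := {χ : L.Formula α // (∃ a : α → M, χ.Realize a) ∧ ∀ a : α → M, χ.Realize a → φ.Realize a}
  have step : ∀ (χ : T) (n : ℕ), ∃ χ' : T, (∀ a : α → M, χ'.1.Realize a → χ.1.Realize a) ∧
      ¬ χ'.1.Realize (e n) := by
    rintro ⟨χ, ⟨a, ha⟩, hχ⟩ n
    have hna := hcon a (hχ a ha)
    unfold Iso at hna
    push Not at hna
    obtain ⟨b, hb, ψ, hψa, hψb⟩ := hna χ ha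
    by_cases hn : ψ.Realize (e n)
    · refine ⟨⟨χ ⊓ ∼ψ, ⟨b, ?_⟩, ?_⟩, ?_, ?_⟩
      · simp [hb, hψb]
      · intro c hc
        simp at hc
        exact hχ c hc.1
      · intro c hc
        simp at hc
        exact hc.1
      · simp [hn]
    · refine ⟨⟨χ ⊓ ψ, ⟨a, ?_⟩, ?_⟩, ?_, ?_⟩
      · simp [ha, hψa]
      · intro c hc
        simp at hc
        exact hχ c hc.1
      · intro c hc
        simp at hc
        exact hc.1
      · simp [hn]
  choose nxt hn1 hn2 using step
  let s : ℕ → T := fun n => Nat.rec ⟨φ, h, fun _ h => h⟩ (fun n χ => nxt χ n) n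
  have hs : ∀ n, s (n + 1) = nxt (s n) n := fun n => rfl
  have hmono : ∀ n i, i ≤ n → ∀ a : α → M, (s n).1.Realize a → (s i).1.Realize a := by
    intro n i hi
    induction hi with
    | refl => exact fun _ h => h
    | step _ ih =>
      intro a ha
      rw [hs] at ha
      exact ih a (hn1 _ _ a ha)
  obtain ⟨w, hw⟩ := realize_seq hL homega (fun n => (s n).1) (by
    intro n
    obtain ⟨a, ha⟩ := (s n).2.1
    exact ⟨a, fun i hi => hmono n i hi a ha⟩)
  obtain ⟨n, rfl⟩ := he w
  have := hw (n + 1)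
  simp only [hs] at this
  exact hn2 _ _ this

theorem iso_comp {α β : Type} [Finite α] [Finite β] (a : α → M) (ha : Iso L a) (g : β → α) :
    Iso L (a ∘ g) := by
  obtain ⟨θ, h1, h2⟩ := ha
  let η : L.Formula (β ⊕ α) := (θ.relabel Sum.inr) ⊓
    Formula.iInf (fun j : β => Term.equal (Term.var (Sum.inl j)) (Term.var (Sum.inr (g j))))
  have hη : ∀ (b : β → M) (c : α → M), η.Realize (Sum.elim b c) ↔
      θ.Realize c ∧ ∀ j, b j = c (g j) := by
    intro b c
    simp [η, Formula.realize_inf, Formula.realize_relabel]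
  refine ⟨Formula.iExs α η, ?_, ?_⟩
  · rw [Formula.realize_iExs]
    exact ⟨a, (hη _ _).2 ⟨h1, fun _ => rfl⟩⟩
  · intro b hb ψ hψ
    rw [Formula.realize_iExs] at hb
    obtain ⟨c, hc⟩ := hb
    obtain ⟨hc1, hc2⟩ := (hη _ _).1 hc
    have := h2 c hc1 (ψ.relabel g) (by rw [Formula.realize_relabel]; exact hψ)
    rw [Formula.realize_relabel] at this
    have hbc : b = c ∘ g := funext hc2
    rw [hbc]; exact this

theorem iso_iff {α : Type} {a b : α → M} {θ : L.Formula α}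
    (h : ∀ b : α → M, θ.Realize b → ∀ ψ : L.Formula α, ψ.Realize a → ψ.Realize b)
    (hb : θ.Realize b) (ψ : L.Formula α) : ψ.Realize a ↔ ψ.Realize b := by
  refine ⟨h b hb ψ, fun hψ => ?_⟩
  by_contra hc
  have := h b hb (∼ψ) (by simpa using hc)
  simp at this
  exact this hψ

/-- One-step extension of an isolated finite set. -/
theorem iso_extend [Countable M] [Infinite M] (hL : L.card ≤ Cardinal.aleph0)
    (homega : OmegaCategorical L M) (s : Finset M) (hs : Iso L (fun x : s => (x : M)))
    {n : ℕ} (φ : L.BoundedFormula Empty (n + 1)) (x : Fin n → M) (hx : ∀ i, x i ∈ s) (a : M)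
    (ha : φ.Realize default (Fin.snoc x a : _ → M)) :
    ∃ t : Finset M, s ⊆ t ∧ Iso L (fun x : t => (x : M)) ∧
      ∃ b ∈ t, φ.Realize default (Fin.snoc x b : _ → M) := by
  classical
  obtain ⟨θ, h1, h2⟩ := hs
  let φ' : L.Formula (s ⊕ Unit) := φ.toFormula.relabel
    (Sum.elim Empty.elim (Fin.snoc (α := fun _ => s ⊕ Unit)
      (fun i => Sum.inl (⟨x i, hx i⟩ : s)) (Sum.inr ())))
  have hφ' : ∀ b : M, φ'.Realize (Sum.elim (fun x : s => (x : M)) (fun _ => b)) ↔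
      φ.Realize default (Fin.snoc x b : _ → M) := by
    intro b
    simp only [φ', Formula.realize_relabel, BoundedFormula.realize_toFormula]
    have e1 : ((Sum.elim (fun x : s => (x : M)) (fun _ : Unit => b)) ∘
      (Sum.elim Empty.elim (Fin.snoc (α := fun _ => s ⊕ Unit)
      (fun i => Sum.inl (⟨x i, hx i⟩ : s)) (Sum.inr ())))) ∘ Sum.inl = default :=
        Subsingleton.elim _ _
    have e2 : ((Sum.elim (fun x : s => (x : M)) (fun _ : Unit => b)) ∘
      (Sum.elim Empty.elim (Fin.snoc (α := fun _ => s ⊕ Unit)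
      (fun i => Sum.inl (⟨x i, hx i⟩ : s)) (Sum.inr ())))) ∘ Sum.inr = (Fin.snoc x b : _ → M) := by
      funext i
      refine Fin.lastCases ?_ (fun j => ?_) i
      · simp
      · simp
    rw [e1, e2]
  obtain ⟨c, hc, θ', h1', h2'⟩ := iso_dense hL homega (φ' ⊓ θ.relabel Sum.inl)
    ⟨Sum.elim (fun x : s => (x : M)) (fun _ => a), by
      rw [Formula.realize_inf, hφ', Formula.realize_relabel]
      exact ⟨ha, h1⟩⟩
  rw [Formula.realize_inf, Formula.realize_relabel (φ := θ)] at hc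
  have hE : (Formula.iExs Unit θ').Realize (fun x : s => (x : M)) := by
    rw [iso_iff h2 hc.2, Formula.realize_iExs]
    refine ⟨c ∘ Sum.inr, ?_⟩
    convert h1'
    simp
  rw [Formula.realize_iExs] at hE
  obtain ⟨d, hd⟩ := hE
  have hd' : d = fun _ => d () := by funext i; rfl
  rw [hd'] at hd
  have hIso : Iso L (Sum.elim (fun x : s => (x : M)) (fun _ : Unit => d ())) := by
    refine ⟨θ', hd, fun b hb ψ hψ => ?_⟩
    rw [← iso_iff h2' hd] at hψ
    exact h2' b hb ψ hψ
  refine ⟨insert (d ()) s, Finset.subset_insert _ _, ?_, d (), Finset.mem_insert_self _ _, ?_⟩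
  · let g : (insert (d ()) s : Finset M) → s ⊕ Unit := fun y =>
      if h : (y : M) ∈ s then Sum.inl ⟨y, h⟩ else Sum.inr ()
    have := iso_comp _ hIso g
    convert this using 1
    funext y
    simp only [g, Function.comp]
    split_ifs with h
    · simp
    · have := Finset.mem_insert.1 y.2
      simpa [h] using this
  · rw [← hφ', ← iso_iff h2' hd]
    exact hc.1

theorem all_iso [Countable M] [Infinite M] (hrel : ∀ i, IsEmpty (L.Functions i))
    (hL : L.card ≤ Cardinal.aleph0)
    (homega : OmegaCategorical L M) {α : Type} [Finite α] (a : α → M) : Iso L a := by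
  classical
  let P := {s : Finset M // Iso L (fun x : s => (x : M))}
  have hempty : Iso L (fun x : (∅ : Finset M) => (x : M)) := by
    refine ⟨⊤, by simp, fun b _ ψ hψ => ?_⟩
    have : b = (fun x : (∅ : Finset M) => (x : M)) := Subsingleton.elim _ _
    rw [this]; exact hψ
  let ι := Σ n : ℕ, L.BoundedFormula Empty (n + 1) × (Fin n → M)
  have hfc : ∀ n, Countable (L.BoundedFormula Empty n) := by
    intro n
    have h1 : Countable (Σ n, L.BoundedFormula Empty n) := by
      rw [← Cardinal.mk_le_aleph0_iff]
      refine BoundedFormula.card_le.trans ?_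
      simpa using hL
    exact (sigma_mk_injective (i := n)).countable
  have : Countable ι := inferInstance
  letI : Encodable ι := Encodable.ofCountable ι
  let D : ι → Order.Cofinal P := fun i =>
    { carrier := {s | (¬ ∃ t : P, s ≤ t ∧ ∀ j, i.2.2 j ∈ t.1) ∨
        ((∃ a, i.2.1.Realize default (Fin.snoc i.2.2 a : _ → M)) →
          ∃ b ∈ s.1, i.2.1.Realize default (Fin.snoc i.2.2 b : _ → M))}
      isCofinal := by
        intro s
        by_cases h : ∃ t : P, s ≤ t ∧ ∀ j, i.2.2 j ∈ t.1
        · obtain ⟨t, hst, ht⟩ := h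
          by_cases h' : ∃ a, i.2.1.Realize default (Fin.snoc i.2.2 a : _ → M)
          · obtain ⟨a, ha⟩ := h'
            obtain ⟨r, hr, hr2, hr3⟩ := iso_extend hL homega t.1 t.2 i.2.1 i.2.2 ht a ha
            exact ⟨⟨r, hr2⟩, Or.inr (fun _ => hr3), hst.trans hr⟩
          · exact ⟨s, Or.inr (fun h => absurd h h'), le_rfl⟩
        · exact ⟨s, Or.inl h, le_rfl⟩ }
  let G := Order.idealOfCofinals (⟨∅, hempty⟩ : P) D
  let N : L.Substructure M :=
    { carrier := {x | ∃ s ∈ G, x ∈ s.1}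
      fun_mem := fun {n} f => (hrel n).elim f }
  have hcap : ∀ {β : Type} [Finite β] (x : β → N), ∃ s ∈ G, ∀ j, (x j : M) ∈ s.1 := by
    intro β _ x
    have hx : ∀ j, ∃ s ∈ G, (x j : M) ∈ s.1 := fun j => (x j).2
    choose s hs hxs using hx
    have : IsDirected G (· ≤ ·) := by
      refine ⟨fun a b => ?_⟩
      obtain ⟨c, hc, h1, h2⟩ := G.directed a.1 a.2 b.1 b.2
      exact ⟨⟨c, hc⟩, h1, h2⟩
    have : Nonempty G := ⟨⟨_, Order.mem_idealOfCofinals _ D⟩⟩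
    obtain ⟨t, ht⟩ := Finite.exists_le (fun j => (⟨s j, hs j⟩ : G))
    exact ⟨t.1, t.2, fun j => ht j (hxs j)⟩
  have hel : N.IsElementary := by
    apply Substructure.isElementary_of_exists
    intro n φ x a ha
    obtain ⟨t, ht, hxt⟩ := hcap x
    obtain ⟨s, hsD, hs⟩ := Order.cofinal_meets_idealOfCofinals (⟨∅, hempty⟩ : P) D
      ⟨n, φ, fun j => x j⟩
    rcases hsD with h | h
    · obtain ⟨r, hr, h1, h2⟩ := G.directed s hs t ht
      exact absurd ⟨r, h1, fun j => h2 (hxt j)⟩ h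
    · obtain ⟨b, hb, hb2⟩ := h ⟨a, ha⟩
      exact ⟨⟨b, s, hs, hb⟩, hb2⟩
  let S : L.ElementarySubstructure M := ⟨N, hel⟩
  obtain ⟨e⟩ := homega S (inferInstanceAs (Countable N)) (by
    intro ψ hψ
    rw [S.realize_sentence]
    exact hψ)
  have key : ∀ ψ : L.Formula α, ψ.Realize (fun i => ((e (a i) : S) : M)) ↔ ψ.Realize a := by
    intro ψ
    rw [← StrongHomClass.realize_formula e ψ (v := a)]
    exact S.subtype.map_formula ψ _
  obtain ⟨s, hs, hxs⟩ := hcap (β := α) (fun i => (e (a i) : S))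
  have hI : Iso L (fun i => ((e (a i) : S) : M)) :=
    iso_comp _ s.2 (fun i => (⟨((e (a i) : S) : M), hxs i⟩ : s.1))
  obtain ⟨θ, h1, h2⟩ := hI
  exact ⟨θ, (key θ).1 h1, fun b hb ψ hψ => h2 b hb ψ ((key ψ).2 hψ)⟩

/-- Ryll-Nardzewski: finitely many types are realized. -/
theorem finite_types [Countable M] [Infinite M] (hrel : ∀ i, IsEmpty (L.Functions i))
    (hL : L.card ≤ Cardinal.aleph0)
    (homega : OmegaCategorical L M) {α : Type} [Finite α] :
    (Set.range (fun a : α → M => {ψ : L.Formula α | ψ.Realize a})).Finite := by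
  have hI := fun a : α → M => all_iso hrel hL homega a
  choose θ h1 h2 using hI
  obtain ⟨e, he⟩ := exists_surjective_nat (α → M)
  have : ¬ ∀ n, ∃ w : α → M, ∀ i ≤ n, Formula.Realize (∼(θ (e i))) w := by
    intro hc
    obtain ⟨w, hw⟩ := realize_seq hL homega _ hc
    obtain ⟨n, rfl⟩ := he w
    have := hw n
    simp at this
    exact this (h1 _)
  push Not at this
  obtain ⟨n, hn⟩ := this
  refine ((Set.finite_Iic n).image
    (fun i => {ψ : L.Formula α | ψ.Realize (e i)})).subset ?_
  rintro _ ⟨a, rfl⟩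
  obtain ⟨i, hi, hia⟩ := hn a
  refine ⟨i, hi, ?_⟩
  ext ψ
  simp at hia
  exact iso_iff (h2 (e i)) hia ψ

end RN
section PP
universe u v
variable {L : FirstOrder.Language.{u, v}} {M : Type} [L.Structure M]

theorem pp_preserved (hrel : ∀ i, IsEmpty (L.Functions i)) {k : ℕ} (f : (Fin k → M) → M)
    (hf : IsPoly L M f) {α : Type} {n : ℕ} {φ : L.BoundedFormula α n}
    (hφ : IsPrimitivePositive φ) (w : Fin k → α → M) (x : Fin k → Fin n → M)
    (h : ∀ j, φ.Realize (w j) (x j)) :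
    φ.Realize (fun i => f (fun j => w j i)) (fun i => f (fun j => x j i)) := by
  have hterm : ∀ {n : ℕ} (x : Fin k → Fin n → M) (t : L.Term (α ⊕ Fin n)),
      t.realize (Sum.elim (fun i => f (fun j => w j i)) (fun i => f (fun j => x j i))) =
      f (fun j => t.realize (Sum.elim (w j) (x j))) := by
    intro n x t
    cases t with
    | var i => cases i <;> rfl
    | func g _ => exact (hrel _).elim g
  induction hφ with
  | atomic ha =>
    cases ha with
    | equal t₁ t₂ =>
      simp only [BoundedFormula.realize_bdEqual] at h ⊢
      rw [hterm, hterm]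
      simp only [h]
    | rel r ts =>
      simp only [BoundedFormula.realize_rel] at h ⊢
      simp only [hterm]
      exact hf _ r (fun j i => (ts i).realize (Sum.elim (w j) (x j))) h
  | inf _ _ ih1 ih2 =>
    simp only [BoundedFormula.realize_inf] at h ⊢
    exact ⟨ih1 x (fun j => (h j).1), ih2 x (fun j => (h j).2)⟩
  | ex _ ih =>
    simp only [BoundedFormula.realize_ex] at h ⊢
    choose a ha using h
    refine ⟨f a, ?_⟩
    have := ih (fun j => Fin.snoc (x j) (a j)) ha
    convert this using 1
    funext i
    refine Fin.lastCases ?_ (fun i => ?_) i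
    · simp
    · simp

theorem pp_top {α : Type} [Nonempty M] (n : ℕ) : ∃ φ : L.BoundedFormula α n,
    IsPrimitivePositive φ ∧ ∀ (w : α → M) (x : Fin n → M), φ.Realize w x := by
  refine ⟨(Term.bdEqual (Term.var (Sum.inr (Fin.last n))) (Term.var (Sum.inr (Fin.last n)))).ex,
    .ex (.atomic (.equal _ _)), fun w x => ?_⟩
  simp [BoundedFormula.realize_ex]

theorem pp_conj {n : ℕ} {α : Type} [Nonempty M] {ι : Type*} (s : Set ι)
    (hs : s.Finite)
    (φ : ι → L.BoundedFormula α n) (hφ : ∀ i, IsPrimitivePositive (φ i)) :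
    ∃ ψ : L.BoundedFormula α n, IsPrimitivePositive ψ ∧
      ∀ (w : α → M) (x : Fin n → M), ψ.Realize w x ↔ ∀ i ∈ s, (φ i).Realize w x := by
  induction s, hs using Set.Finite.induction_on with
  | empty =>
    obtain ⟨ψ, h1, h2⟩ := pp_top (L := L) (M := M) (α := α) n
    exact ⟨ψ, h1, fun w x => by simp [h2]⟩
  | @insert a s _ _ ih =>
    obtain ⟨ψ, h1, h2⟩ := ih
    exact ⟨φ a ⊓ ψ, .inf (hφ a) h1, fun w x => by simp [h2]⟩

/-- If each tuple in `X` violates some formula in a set `S` of pp formulas, then finitely many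
suffice. -/
theorem pp_compact [Nonempty M] {m n : ℕ}
    (hfin : (Set.range (fun a : Fin m ⊕ Fin n → M =>
      {ψ : L.Formula (Fin m ⊕ Fin n) | ψ.Realize a})).Finite)
    (S : Set (L.BoundedFormula (Fin m) n)) (hS : ∀ φ ∈ S, IsPrimitivePositive φ)
    (X : Set ((Fin m → M) × (Fin n → M)))
    (hX : ∀ p ∈ X, ∃ φ ∈ S, ¬ φ.Realize p.1 p.2) :
    ∃ ψ : L.BoundedFormula (Fin m) n, IsPrimitivePositive ψ ∧
      (∀ (w : Fin m → M) (x : Fin n → M), (∀ φ ∈ S, φ.Realize w x) → ψ.Realize w x) ∧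
      ∀ p ∈ X, ¬ ψ.Realize p.1 p.2 := by
  classical
  let tp : ((Fin m → M) × (Fin n → M)) → Set (L.Formula (Fin m ⊕ Fin n)) :=
    fun p => {ψ | ψ.Realize (Sum.elim p.1 p.2)}
  have hfin' : (tp '' X).Finite := by
    refine hfin.subset ?_
    rintro _ ⟨p, _, rfl⟩
    exact ⟨Sum.elim p.1 p.2, rfl⟩
  have hft : Finite (tp '' X) := hfin'.to_subtype
  choose p hpX hp using fun T : (tp '' X) => T.2
  choose φ hφS hφ using fun T : (tp '' X) => hX (p T) (hpX T)
  obtain ⟨ψ, h1, h2⟩ := pp_conj (M := M) (Set.univ : Set (tp '' X)) Set.finite_univ φ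
    (fun T => hS _ (hφS T))
  refine ⟨ψ, h1, fun w x h => (h2 w x).2 (fun T _ => h _ (hφS T)), fun q hq hψ => ?_⟩
  have h3 := (h2 q.1 q.2).1 hψ ⟨tp q, q, hq, rfl⟩ (Set.mem_univ _)
  have h4 := hp ⟨tp q, q, hq, rfl⟩
  apply hφ ⟨tp q, q, hq, rfl⟩
  have h5 : (φ ⟨tp q, q, hq, rfl⟩).toFormula ∈ tp q := by
    simpa [tp] using h3
  have h6 := h4.ge h5
  simpa [tp] using h6

/-- The extension condition. -/
def PPle (L : FirstOrder.Language.{u, v}) {M : Type} [L.Structure M] {m k : ℕ}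
    (t : Fin k → Fin m → M) (b : Fin m → M) {n : ℕ}
    (e : ℕ → Fin k → M) (c : Fin n → M) : Prop :=
  ∀ φ : L.BoundedFormula (Fin m) n, IsPrimitivePositive φ →
    (∀ j, φ.Realize (t j) (fun i => e i j)) → φ.Realize b c

theorem pp_extend [Nonempty M] {m k : ℕ}
    (hfin : ∀ n, (Set.range (fun a : Fin m ⊕ Fin n → M =>
      {ψ : L.Formula (Fin m ⊕ Fin n) | ψ.Realize a})).Finite)
    (t : Fin k → Fin m → M) (b : Fin m → M) {n : ℕ}
    (e : ℕ → Fin k → M) (c : Fin n → M) (h : PPle L t b e c) :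
    ∃ c' : M, PPle L t b e (Fin.snoc c c' : Fin (n + 1) → M) := by
  by_contra hcon
  push Not at hcon
  obtain ⟨ψ, h1, h2, h3⟩ := pp_compact (hfin (n + 1))
    {φ : L.BoundedFormula (Fin m) (n + 1) | IsPrimitivePositive φ ∧
      ∀ j, φ.Realize (t j) (fun i => e i j)} (fun φ h => h.1)
    (Set.range (fun c' : M => (b, (Fin.snoc c c' : Fin (n + 1) → M)))) (by
      rintro _ ⟨c', rfl⟩
      have := hcon c'
      unfold PPle at this
      push Not at this
      obtain ⟨φ, hφ, h1, h2⟩ := this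
      exact ⟨φ, ⟨hφ, h1⟩, h2⟩)
  have := h ψ.ex (.ex h1) (by
    intro j
    rw [BoundedFormula.realize_ex]
    refine ⟨e n j, ?_⟩
    apply h2
    intro φ hφ
    convert hφ.2 j using 1
    funext i
    refine Fin.lastCases ?_ (fun i => ?_) i
    · simp
    · simp)
  rw [BoundedFormula.realize_ex] at this
  obtain ⟨c', hc'⟩ := this
  exact h3 _ ⟨c', rfl⟩ hc'

theorem exists_poly [Nonempty M] {m k : ℕ}
    (hfin : ∀ n, (Set.range (fun a : Fin m ⊕ Fin n → M =>
      {ψ : L.Formula (Fin m ⊕ Fin n) | ψ.Realize a})).Finite)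
    [Countable M]
    (t : Fin k → Fin m → M) (b : Fin m → M)
    (h : ∀ φ : L.Formula (Fin m), IsPrimitivePositive φ →
      (∀ j, φ.Realize (t j)) → φ.Realize b) :
    ∃ f : (Fin k → M) → M, IsPoly L M f ∧ ∀ i, f (fun j => t j i) = b i := by
  obtain ⟨e, he⟩ := exists_surjective_nat (Fin k → M)
  have h0 : PPle L t b e (default : Fin 0 → M) := by
    intro φ hφ hj
    refine h φ hφ (fun j => ?_)
    rw [Formula.Realize]
    convert hj j using 1
  choose nxt hnxt using fun (n : ℕ) (c : {c : Fin n → M // PPle L t b e c}) =>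
    pp_extend hfin t b e c.1 c.2
  let F : ∀ n, {c : Fin n → M // PPle L t b e c} := fun n =>
    Nat.rec ⟨default, h0⟩ (fun n c => ⟨Fin.snoc c.1 (nxt n c), hnxt n c⟩) n
  have hF : ∀ n, (F (n + 1)).1 = Fin.snoc (F n).1 (nxt n (F n)) := fun n => rfl
  let c : ℕ → M := fun n => nxt n (F n)
  have hc : ∀ n, (F n).1 = fun i : Fin n => c i := by
    intro n
    induction n with
    | zero => exact Subsingleton.elim _ _
    | succ n ih =>
      rw [hF, ih]
      funext i
      refine Fin.lastCases ?_ (fun i => ?_) i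
      · simp [c]
      · simp
  have hP : ∀ (n : ℕ) (φ : L.BoundedFormula (Fin m) n), IsPrimitivePositive φ →
    (∀ j, φ.Realize (t j) (fun i => e i j)) → φ.Realize b (fun i : Fin n => c i) := by
    intro n
    have := (F n).2
    rw [hc] at this
    exact this
  choose ix hix using he
  refine ⟨fun x => c (ix x), ?_, ?_⟩
  · intro n r rows hrows
    let idx : Fin n → ℕ := fun i => ix (fun j => rows j i)
    obtain ⟨N, hN⟩ : ∃ N, ∀ i, idx i < N := by
      obtain ⟨N, hN⟩ := Finite.exists_le idx
      exact ⟨N + 1, fun i => Nat.lt_succ_of_le (hN i)⟩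
    have := hP N (r.boundedFormula (fun i => Term.var (Sum.inr ⟨idx i, hN i⟩)))
      (.atomic (.rel _ _)) (by
        intro j
        simp only [BoundedFormula.realize_rel, Term.realize_var, Sum.elim_inr, idx, hix]
        exact hrows j)
    simpa only [BoundedFormula.realize_rel, Term.realize_var, Sum.elim_inr] using this
  · intro i
    let q := ix (fun j => t j i)
    have := hP (q + 1) (Term.bdEqual (Term.var (Sum.inr (Fin.last q))) (Term.var (Sum.inl i)))
      (.atomic (.equal _ _)) (by
        intro j
        simp [BoundedFormula.realize_bdEqual, q, hix])
    simpa [BoundedFormula.realize_bdEqual] using this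

end PP

/-- **Theorem 3 (4).**  Over a countably infinite ω-categorical structure with countable
relational signature, a relation is primitive positive definable if and only if it is
preserved by all polymorphisms. -/
theorem pp_definable_iff_preserved_by_polymorphisms
    (L : Language) (M : Type) [L.Structure M] [Countable M] [Infinite M]
    (hrel : ∀ i, IsEmpty (L.Functions i)) (hcnt : Countable (Σ i, L.Relations i))
    (homega : OmegaCategorical L M) (m : ℕ) (R : (Fin m → M) → Prop) :
    (∃ φ : L.Formula (Fin m), IsPrimitivePositive φ ∧ ∀ x, R x ↔ φ.Realize x) ↔
      ∀ (k : ℕ) (f : (Fin k → M) → M), IsPoly L M f → Preserves f R := by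
  constructor
  · rintro ⟨φ, hφ, hR⟩ k f hf rows hrows
    rw [hR]
    have := pp_preserved hrel f hf hφ rows (fun _ => default) (fun j => (hR _).1 (hrows j))
    rw [Formula.Realize]
    convert this
  · intro hpres
    have hL := card_le_aleph0 hrel hcnt
    have hfin : ∀ n, (Set.range (fun a : Fin m ⊕ Fin n → M =>
      {ψ : L.Formula (Fin m ⊕ Fin n) | ψ.Realize a})).Finite :=
      fun n => finite_types hrel hL homega
    have hfin0 : (Set.range (fun a : Fin m → M => {ψ : L.Formula (Fin m) | ψ.Realize a})).Finite :=
      finite_types hrel hL homega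
    -- representatives of the types in `R`
    obtain ⟨k, t, htR, ht⟩ : ∃ (k : ℕ) (t : Fin k → Fin m → M), (∀ j, R (t j)) ∧
        ∀ a, R a → ∃ j, ∀ ψ : L.Formula (Fin m), ψ.Realize (t j) → ψ.Realize a := by
      have hf : ((fun a : Fin m → M => {ψ : L.Formula (Fin m) | ψ.Realize a}) '' {a | R a}).Finite :=
        hfin0.subset (Set.image_subset_range _ _)
      have := hf.to_subtype
      obtain ⟨k, ⟨g⟩⟩ := Finite.exists_equiv_fin
        ((fun a : Fin m → M => {ψ : L.Formula (Fin m) | ψ.Realize a}) '' {a | R a})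
      choose t ht1 ht2 using fun j : Fin k => (g.symm j).2
      refine ⟨k, t, ht1, fun a ha => ⟨g ⟨_, a, ha, rfl⟩, fun ψ hψ => ?_⟩⟩
      have := ht2 (g ⟨_, a, ha, rfl⟩)
      rw [Equiv.symm_apply_apply] at this
      exact this.le hψ
    obtain ⟨ψ, h1, h2, h3⟩ := pp_compact (hfin 0)
      {φ : L.BoundedFormula (Fin m) 0 | IsPrimitivePositive φ ∧
        ∀ j, φ.Realize (t j) default} (fun φ h => h.1)
      {p | ¬ R p.1} (by
        rintro ⟨b, x⟩ hb
        by_contra hcon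
        push Not at hcon
        obtain ⟨f, hf, hfb⟩ := exists_poly hfin t b (by
          intro φ hφ hj
          have := hcon φ ⟨hφ, hj⟩
          rw [Formula.Realize]
          convert this)
        have := hpres k f hf t htR
        simp only [hfb] at this
        exact hb this)
    refine ⟨ψ, h1, fun x => ⟨fun hx => ?_, fun hx => ?_⟩⟩
    · obtain ⟨j, hj⟩ := ht x hx
      exact hj ψ (h2 _ _ (fun φ hφ => hφ.2 j))
    · by_contra hn
      exact h3 (x, default) hn hx

end PaperDef
end

section
/- Let Ξ be a countably infinite ordered Ramsey structure with relational signature, let Ω be a countably infinite ω-categorical structure with countable signature, and let f be any function from the domain of Ξ to the domain of Ω. Then for every finite induced substructure F of Ξ there exists an induced substructure F′ of Ξ isomorphic to F such that f is canonical on F′. -/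
open FirstOrder FirstOrder.Language

namespace PaperDef
open Set Cardinal

section RN
variable {L : Language} {Ω : Type} [L.Structure Ω]

/-- Same type for tuples with arbitrary index type, in terms of definable sets. -/
def SameT (L : Language) {Ω : Type} [L.Structure Ω] {α : Type} (a b : α → Ω) : Prop :=
  ∀ φ : L.Formula α, φ.Realize a ↔ φ.Realize b

theorem SameT.mem {α : Type} {a b : α → Ω} (h : SameT L a b) {D : Set (α → Ω)}
    (hD : (∅ : Set Ω).Definable L D) : a ∈ D ↔ b ∈ D := by
  obtain ⟨φ, rfl⟩ := Set.empty_definable_iff.1 hD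
  exact h φ

theorem SameT.comp {α β : Type} {a b : α → Ω} (h : SameT L a b) (g : β → α) :
    SameT L (a ∘ g) (b ∘ g) := by
  intro φ
  rw [← Formula.realize_relabel, ← Formula.realize_relabel]
  exact h _

theorem SameT.symm {α : Type} {a b : α → Ω} (h : SameT L a b) : SameT L b a :=
  fun φ => (h φ).symm

theorem SameT.trans {α : Type} {a b c : α → Ω} (h : SameT L a b) (h' : SameT L b c) :
    SameT L a c :=
  fun φ => (h φ).trans (h' φ)

/-- The tuple has an isolated type. -/
def Atomic (L : Language) {Ω : Type} [L.Structure Ω] {α : Type} (c : α → Ω) : Prop :=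
  ∃ D : Set (α → Ω), (∅ : Set Ω).Definable L D ∧ c ∈ D ∧ ∀ b ∈ D, SameT L b c

theorem realized [Countable Ω] [Infinite Ω] [Countable L.Symbols]
    (homega : OmegaCategorical L Ω) {α : Type} [Countable α] (Γ : Set (L.Formula α))
    (hfin : ∀ Γ0 : Finset (L.Formula α), (Γ0 : Set (L.Formula α)) ⊆ Γ →
      ∃ v : α → Ω, ∀ φ ∈ Γ0, φ.Realize v) :
    ∃ v : α → Ω, ∀ φ ∈ Γ, φ.Realize v := by
  classical
  let T : L[[α]].Theory := ((L.lhomWithConstants α).onTheory (L.completeTheory Ω) ∪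
    Formula.equivSentence '' Γ) ∪ L[[α]].infiniteTheory
  have hsat : T.IsSatisfiable := by
    rw [Theory.isSatisfiable_iff_isFinitelySatisfiable]
    intro T0 hT0
    obtain ⟨v, hv⟩ := hfin ((T0.image Formula.equivSentence.symm).filter (· ∈ Γ)) (by
      intro φ hφ
      simp only [Finset.coe_filter, mem_ofPred_eq] at hφ
      exact hφ.2)
    let := constantsOn.structure v
    have : Ω ⊨ (T0 : L[[α]].Theory) := by
      refine ⟨fun φ hφ => ?_⟩
      rcases hT0 hφ with (h | h) | h
      · have : Ω ⊨ (L.lhomWithConstants α).onTheory (L.completeTheory Ω) := by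
          rw [LHom.onTheory_model]; infer_instance
        exact this.realize_of_mem φ h
      · obtain ⟨ψ, hψ, rfl⟩ := h
        rw [Formula.realize_equivSentence]
        apply hv
        simp only [Finset.mem_filter, Finset.mem_image]
        exact ⟨⟨_, hφ, by simp⟩, hψ⟩
      · have : Ω ⊨ L[[α]].infiniteTheory := by
          rw [model_infiniteTheory_iff]; infer_instance
        exact this.realize_of_mem φ h
    exact Theory.Model.isSatisfiable Ω
  obtain ⟨M⟩ := hsat
  have hM : Infinite M := by
    rw [← model_infiniteTheory_iff (L := L[[α]])]
    exact Theory.Model.mono M.is_model subset_union_right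
  obtain ⟨N, hN⟩ := Theory.exists_model_card_eq ⟨M, hM⟩ (ℵ₀ : Cardinal.{0}) le_rfl (by
    have : L[[α]].card ≤ ℵ₀ := by
      exact mk_le_aleph0_iff.2 inferInstance
    simpa using this)
  let : L.Structure N := (L.lhomWithConstants α).reduct N
  have : (L.lhomWithConstants α).IsExpansionOn N := LHom.isExpansionOn_reduct _ _
  have hN1 : N ⊨ (L.completeTheory Ω) := by
    rw [← LHom.onTheory_model (L.lhomWithConstants α)]
    exact Theory.Model.mono N.is_model (subset_union_left.trans subset_union_left)
  have hcN : Countable N := mk_le_aleph0_iff.1 hN.le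
  obtain ⟨g⟩ := homega N hcN (fun φ hφ => hN1.realize_of_mem φ hφ)
  refine ⟨fun a => g.symm (L.con a : N), fun φ hφ => ?_⟩
  have h1 : N ⊨ Formula.equivSentence φ :=
    N.is_model.realize_of_mem _ (Or.inl (Or.inr ⟨φ, hφ, rfl⟩))
  have h2 := (Formula.realize_equivSentence N φ).1 h1
  exact (StrongHomClass.realize_formula g.symm φ).2 h2

theorem Atomic.comp {α β : Type} [Finite α] [Finite β] {c : α → Ω} (h : Atomic L c) (g : β → α) :
    Atomic L (c ∘ g) := by
  obtain ⟨D, hD, hc, h⟩ := h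
  refine ⟨_, hD.image_comp g, ⟨c, hc, rfl⟩, ?_⟩
  rintro _ ⟨b, hb, rfl⟩
  exact (h b hb).comp g

variable [Countable Ω] [Infinite Ω] [Countable L.Symbols]

theorem exists_atomic (homega : OmegaCategorical L Ω) {α : Type} [Finite α]
    {D : Set (α → Ω)} (hD : (∅ : Set Ω).Definable L D) (hne : D.Nonempty) :
    ∃ c ∈ D, Atomic L c := by
  classical
  by_contra! hno
  have hc : Countable (α → Ω) := inferInstance
  obtain ⟨t, ht⟩ := exists_surjective_nat (α → Ω)
  let Sg := {E : Set (α → Ω) // (∅ : Set Ω).Definable L E ∧ E.Nonempty ∧ E ⊆ D}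
  have step : ∀ (E : Sg) (s : α → Ω), ∃ E' : Sg, E'.1 ⊆ E.1 ∧ s ∉ E'.1 := by
    rintro ⟨E, hE, hEn, hED⟩ s
    by_cases hs : s ∈ E
    · have : ∃ b ∈ E, ¬ SameT L b s := by
        by_contra! hcon
        exact hno s (hED hs) ⟨E, hE, hs, hcon⟩
      obtain ⟨b, hb, hbs⟩ := this
      have : ∃ φ : L.Formula α, φ.Realize b ∧ ¬ φ.Realize s := by
        simp only [SameT, not_forall] at hbs
        obtain ⟨φ, hφ⟩ := hbs
        by_cases h : φ.Realize b
        · exact ⟨φ, h, by tauto⟩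
        · refine ⟨φ.not, ?_, ?_⟩ <;> rw [Formula.realize_not] <;> tauto
      obtain ⟨φ, h1, h2⟩ := this
      refine ⟨⟨E ∩ {v | φ.Realize v}, hE.inter (Set.empty_definable_iff.2 ⟨φ, rfl⟩),
        ⟨b, hb, h1⟩, inter_subset_left.trans hED⟩, inter_subset_left, fun h => h2 h.2⟩
    · exact ⟨⟨E, hE, hEn, hED⟩, subset_rfl, hs⟩
  choose nx hnx1 hnx2 using step
  let seq : ℕ → Sg := fun n => Nat.rec ⟨D, hD, hne, subset_rfl⟩ (fun k E => nx E (t k)) n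
  have hanti : Antitone (fun n => (seq n).1) :=
    antitone_nat_of_succ_le (fun n => hnx1 (seq n) (t n))
  have hform : ∀ n, ∃ φ : L.Formula α, (seq n).1 = Set.ofPred φ.Realize :=
    fun n => Set.empty_definable_iff.1 (seq n).2.1
  choose φ hφ using hform
  obtain ⟨v, hv⟩ := realized homega (Set.range φ) (by
    intro Γ0 hΓ0
    have : ∃ N : ℕ, ∀ ψ ∈ Γ0, ∃ n ≤ N, φ n = ψ := by
      have hΓ1 : ∀ ψ : L.Formula α, ψ ∈ Γ0 → ∃ n, φ n = ψ := fun ψ hψ => hΓ0 hψ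
      choose! m hm using hΓ1
      exact ⟨Γ0.sup m, fun ψ hψ => ⟨m ψ, Finset.le_sup hψ, hm ψ hψ⟩⟩
    obtain ⟨N, hN⟩ := this
    obtain ⟨v, hv⟩ := (seq N).2.2.1
    refine ⟨v, fun ψ hψ => ?_⟩
    obtain ⟨n, hn, rfl⟩ := hN ψ hψ
    have : v ∈ (seq n).1 := hanti hn hv
    rw [hφ] at this
    exact this)
  obtain ⟨k, rfl⟩ := ht v
  apply hnx2 (seq k) (t k)
  have : t k ∈ (seq (k+1)).1 := by
    have h1 := hφ (k+1)
    have h2 : t k ∈ Set.ofPred (φ (k+1)).Realize := hv _ ⟨_, rfl⟩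
    rw [← h1] at h2
    exact h2
  exact this

theorem extend_atomic (homega : OmegaCategorical L Ω) {α β : Type} [Finite α] [Finite β]
    (ι : α → β) {c : α → Ω} (hc : Atomic L c) {E : Set (β → Ω)}
    (hE : (∅ : Set Ω).Definable L E) (hne : ∃ d ∈ E, d ∘ ι = c) :
    ∃ d ∈ E, d ∘ ι = c ∧ Atomic L d := by
  obtain ⟨D, hD, hcD, hiso⟩ := hc
  obtain ⟨d, hdE, hd⟩ := hne
  obtain ⟨d2, ⟨hmemE, hmemD⟩, D2, hdef2, hmem2, hiso2⟩ := exists_atomic homega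
    (hE.inter (hD.preimage_comp ι)) ⟨d, hdE, by simpa [hd] using hcD⟩
  have h1 : SameT L (d2 ∘ ι) c := hiso _ hmemD
  have h2 : c ∈ (fun g : β → Ω => g ∘ ι) '' D2 :=
    (h1.mem (hdef2.image_comp ι)).1 ⟨d2, hmem2, rfl⟩
  obtain ⟨d3, hd3, rfl⟩ := h2
  have h3 := hiso2 _ hd3
  exact ⟨d3, (h3.mem hE).2 hmemE, rfl, D2, hdef2, hd3,
    fun b hb => (hiso2 b hb).trans h3.symm⟩

theorem exists_atomic_elementary (homega : OmegaCategorical L Ω) :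
    ∃ S : L.ElementarySubstructure Ω, ∀ A : Finset Ω, (A : Set Ω) ⊆ S →
      Atomic L (fun x : A => (x : Ω)) := by
  classical
  let P := {A : Finset Ω // Atomic L (fun x : A => (x : Ω))}
  let I := Σ A0 : Finset Ω, L.Formula ((A0 : Set Ω) ⊕ Fin 1)
  let Good : I → Ω → Prop := fun i b => i.2.Realize (Sum.elim (fun x => (x : Ω)) (fun _ => b))
  let D : I → Set P := fun i =>
    {A | (∃ b ∈ A.1, Good i b) ∨ (∀ A' : P, A ≤ A' → ¬ i.1 ⊆ A'.1) ∨ ¬ ∃ b, Good i b}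
  have hcof : ∀ i, IsCofinal (D i) := by
    rintro ⟨A0, φ⟩ A
    by_cases h1 : ∀ A' : P, A ≤ A' → ¬ A0 ⊆ A'.1
    · exact ⟨A, Or.inr (Or.inl h1), le_rfl⟩
    by_cases h2 : ∃ b, Good ⟨A0, φ⟩ b
    swap
    · exact ⟨A, Or.inr (Or.inr h2), le_rfl⟩
    push Not at h1
    obtain ⟨⟨B, hB⟩, hAB, hA0⟩ := h1
    obtain ⟨b, hb⟩ := h2
    have hE : (∅ : Set Ω).Definable L ((fun d : (B ⊕ Fin 1) → Ω =>
        d ∘ (Sum.map (fun x : (A0 : Set Ω) => (⟨x.1, hA0 x.2⟩ : B)) id)) ⁻¹'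
        {v | φ.Realize v}) :=
      Set.Definable.preimage_comp _ (Set.empty_definable_iff.2 ⟨φ, rfl⟩)
    obtain ⟨d, hdE, hdc, hd⟩ := extend_atomic homega (Sum.inl : B → B ⊕ Fin 1) hB hE
      ⟨Sum.elim (fun x => (x : Ω)) (fun _ => b), by
        have : Sum.elim (fun x : B => (x : Ω)) (fun _ : Fin 1 => b) ∘
          (Sum.map (fun x : (A0 : Set Ω) => (⟨x.1, hA0 x.2⟩ : B)) id) =
          Sum.elim (fun x : (A0 : Set Ω) => (x : Ω)) (fun _ => b) := by
          funext x; rcases x with x | x <;> rfl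
        change φ.Realize _
        beta_reduce; rw [this]; exact hb, rfl⟩
    have hdB : ∀ x : B, d (Sum.inl x) = x := fun x => congrFun hdc x
    let b' := d (Sum.inr 0)
    have hat : Atomic L (fun x : (insert b' B : Finset Ω) => (x : Ω)) := by
      have := hd.comp (fun x : (insert b' B : Finset Ω) =>
        if h : x.1 ∈ B then (Sum.inl ⟨x.1, h⟩ : B ⊕ Fin 1) else Sum.inr 0)
      convert this using 1
      funext x
      simp only [Function.comp]
      split_ifs with h
      · rw [hdB]
      · have := Finset.mem_insert.1 x.2
        tauto
    refine ⟨⟨insert b' B, hat⟩, Or.inl ⟨b', Finset.mem_insert_self _ _, ?_⟩, ?_⟩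
    · change φ.Realize _ at hdE
      change φ.Realize _
      convert hdE using 1
      funext x
      rcases x with x | x
      · simp [hdB]
      · have : x = 0 := Subsingleton.elim _ _
        subst this
        simp [b']
    · exact le_trans hAB (Finset.subset_insert _ _)
  have hp : Atomic L (fun x : (∅ : Finset Ω) => (x : Ω)) := by
    refine ⟨univ, Set.definable_univ, mem_univ _, fun b _ => ?_⟩
    have : b = (fun x : (∅ : Finset Ω) => (x : Ω)) := by
      funext x; exact absurd x.2 (Finset.notMem_empty _)
    subst this
    exact fun φ => Iff.rfl
  have : Countable I := inferInstance
  let : Encodable I := Encodable.ofCountable I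
  let J := Order.idealOfCofinals (⟨∅, hp⟩ : P) (fun i => ⟨D i, hcof i⟩)
  have hJ : ∀ i, ∃ x : P, x ∈ D i ∧ x ∈ J :=
    Order.cofinal_meets_idealOfCofinals (⟨∅, hp⟩ : P) (fun i => ⟨D i, hcof i⟩)
  let U : Set Ω := {x | ∃ A ∈ J, x ∈ A.1}
  have hU : ∀ A0 : Finset Ω, (A0 : Set Ω) ⊆ U → ∃ A ∈ J, A0 ⊆ A.1 := by
    intro A0
    induction A0 using Finset.induction_on with
    | empty => intro _; obtain ⟨A, hA⟩ := J.nonempty; exact ⟨A, hA, Finset.empty_subset _⟩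
    | insert a s ha ih =>
      intro h
      rw [Finset.coe_insert, insert_subset_iff] at h
      obtain ⟨A, hA, hsA⟩ := ih h.2
      obtain ⟨B, hB, haB⟩ := h.1
      obtain ⟨C, hC, hAC, hBC⟩ := J.directed A hA B hB
      exact ⟨C, hC, Finset.insert_subset (hBC haB) (hsA.trans hAC)⟩
  have hmeet : L.MeetsDefinable U := by
    intro Z hZ hdef
    obtain ⟨A0, hA0, hdef⟩ := Set.definable_iff_finitely_definable.1 hdef
    obtain ⟨φ, hφ⟩ := Set.definable_iff_exists_formula_sum.1 hdef
    have key : ∀ b, b ∈ Z ↔ Good ⟨A0, φ⟩ b := by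
      intro b
      have := Set.ext_iff.1 hφ (fun _ => b)
      exact this
    obtain ⟨A, hA, hAJ⟩ := hJ ⟨A0, φ⟩
    rcases hA with ⟨b, hbA, hb⟩ | h | h
    · exact ⟨b, (key b).2 hb, A, hAJ, hbA⟩
    · obtain ⟨B, hB, hAB⟩ := hU A0 hA0
      obtain ⟨C, hC, hAC, hBC⟩ := J.directed A hAJ B hB
      exact absurd (hAB.trans hBC) (h C hAC)
    · obtain ⟨b, hb⟩ := hZ
      exact absurd ⟨b, (key b).1 hb⟩ h
  refine ⟨hmeet.toElementarySubstructure, fun A hA => ?_⟩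
  have hA' : (A : Set Ω) ⊆ U := by
    rw [← hmeet.closure_eq_self]; exact hA
  obtain ⟨B, hB, hAB⟩ := hU A hA'
  exact B.2.comp (fun x : A => (⟨x.1, hAB x.2⟩ : B.1))

theorem all_atomic (homega : OmegaCategorical L Ω) {α : Type} [Finite α] (t : α → Ω) :
    Atomic L t := by
  classical
  obtain ⟨S, hS⟩ := exists_atomic_elementary homega
  obtain ⟨g⟩ := homega S inferInstance (fun φ hφ => (S.realize_sentence φ).2 hφ)
  let h : Ω ↪ₑ[L] Ω := S.subtype.comp g.toElementaryEmbedding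
  have hh : ∀ x, h x ∈ S := fun x => (g x).2
  have hfin : (Set.range (h ∘ t)).Finite := Set.finite_range _
  have h1 := hS hfin.toFinset (by
    intro x hx
    obtain ⟨a, rfl⟩ := hfin.mem_toFinset.1 hx
    exact hh _)
  have h2 : Atomic L (h ∘ t) :=
    h1.comp (fun a : α => ⟨h (t a), hfin.mem_toFinset.2 ⟨a, rfl⟩⟩)
  obtain ⟨D, hD, hD1, hD2⟩ := h2
  obtain ⟨θ, rfl⟩ := Set.empty_definable_iff.1 hD
  refine ⟨{v | θ.Realize v}, hD, ?_, fun b hb φ => ?_⟩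
  · exact (h.map_formula θ t).1 hD1
  · rw [← h.map_formula φ b, ← h.map_formula φ t]
    exact hD2 _ ((h.map_formula θ b).2 hb) φ

/-- Ryll-Nardzewski: finitely many types. -/
theorem finite_coloring (homega : OmegaCategorical L Ω) (α : Type) [Finite α] :
    ∃ (k : ℕ) (χ : (α → Ω) → Fin k), ∀ s t, χ s = χ t → SameT L s t := by
  classical
  have hat : ∀ t : α → Ω, ∃ θ : L.Formula α, θ.Realize t ∧ ∀ b, θ.Realize b → SameT L b t := by
    intro t
    obtain ⟨D, hD, h1, h2⟩ := all_atomic homega t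
    obtain ⟨θ, rfl⟩ := Set.empty_definable_iff.1 hD
    exact ⟨θ, h1, h2⟩
  choose θ hθ1 hθ2 using hat
  have : ∃ W : Finset (α → Ω), ∀ v : α → Ω, ∃ w ∈ W, (θ w).Realize v := by
    by_contra! hcon
    obtain ⟨v, hv⟩ := realized homega (Set.range fun t => (θ t).not) (by
      intro Γ0 hΓ0
      have hΓ1 : ∀ ψ : L.Formula α, ψ ∈ Γ0 → ∃ t, (θ t).not = ψ := fun ψ hψ => hΓ0 hψ
      choose! m hm using hΓ1
      obtain ⟨v, hv⟩ := hcon (Γ0.image m)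
      refine ⟨v, fun ψ hψ => ?_⟩
      rw [← hm ψ hψ]
      exact Formula.realize_not.2 (hv _ (Finset.mem_image_of_mem _ hψ)))
    exact Formula.realize_not.1 (hv _ ⟨v, rfl⟩) (hθ1 v)
  obtain ⟨W, hW⟩ := this
  choose w hwW hw using hW
  refine ⟨W.card, fun v => W.equivFin ⟨w v, hwW v⟩, fun s t hst => ?_⟩
  have : w s = w t := by simpa using hst
  exact (hθ2 _ _ (hw s)).trans (this ▸ (hθ2 _ _ (hw t)).symm)

end RN
end PaperDef

namespace PaperDef
open Set

section Ramsey
variable {L : Language} {X : Type} [L.Structure X]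

theorem rigid (hord : Ordered L X) {P : Type} [L.Structure P] [Finite P] (u v : P ↪[L] X)
    (h : Set.range u = Set.range v) : (u : P → X) = v := by
  obtain ⟨r, hr⟩ := hord
  let lo : LinearOrder X :=
    { le := fun a b => Structure.RelMap r ![a, b]
      le_refl := fun a => hr.refl a
      le_trans := fun a b c => hr.trans a b c
      le_antisymm := fun a b => hr.antisymm a b
      le_total := fun a b => hr.total a b
      toDecidableLE := Classical.decRel _ }
  have key : ∀ (w : P ↪[L] X) (p q : P), w p ≤ w q ↔ Structure.RelMap r ![p, q] := by
    intro w p q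
    rw [← w.map_rel r ![p, q] ]
    have : (w ∘ ![p, q] : Fin 2 → X) = ![w p, w q] := by
      funext i; fin_cases i <;> rfl
    rw [this]
    exact Iff.rfl
  let lp : LinearOrder P := LinearOrder.lift' u u.injective
  have hle : ∀ p q : P, p ≤ q ↔ Structure.RelMap r ![p, q] := fun p q => key u p q
  have hu : StrictMono u := Monotone.strictMono_of_injective
    (fun p q hpq => (key u p q).2 ((hle p q).1 hpq)) u.injective
  have hv : StrictMono v := Monotone.strictMono_of_injective
    (fun p q hpq => (key v p q).2 ((hle p q).1 hpq)) v.injective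
  exact (StrictMono.range_inj hu hv).1 h

theorem factor (hrel : ∀ i, IsEmpty (L.Functions i)) {P S : Type} [L.Structure P] [L.Structure S]
    (u : P ↪[L] X) (e : S ↪[L] X) (h : Set.range u ⊆ Set.range e) :
    ∃ u' : P ↪[L] S, ∀ p, e (u' p) = u p := by
  have h' : ∀ p, ∃ s, e s = u p := fun p => h ⟨p, rfl⟩
  choose w hw using h'
  refine ⟨⟨⟨w, fun a b hab => u.injective (by rw [← hw, ← hw, hab])⟩,
    fun {n} g => ((hrel n).false g).elim, fun {n} r x => ?_⟩, hw⟩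
  change Structure.RelMap r (w ∘ x) ↔ _
  rw [← e.map_rel, ← u.map_rel]
  have : (e ∘ w ∘ x : Fin n → X) = u ∘ x := by
    funext i; exact hw _
  rw [this]

variable {L' : Language} {Ω : Type} [L'.Structure Ω]
variable [Countable Ω] [Infinite Ω] [Countable L'.Symbols]

theorem ramsey_list (hrel : ∀ i, IsEmpty (L.Functions i))
    (hord : Ordered L X) (hram : RamseyClass (L.age X))
    (homega : OmegaCategorical L' Ω) (f : X → Ω)
    (l : List (CategoryTheory.Bundled.{0} L.Structure))
    (hl : ∀ P ∈ l, P ∈ L.age X ∧ Finite P) :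
    ∀ H ∈ L.age X, ∃ e : H ↪[L] X, ∀ P ∈ l, ∀ u v : P ↪[L] X,
      Set.range u ⊆ Set.range e → Set.range v ⊆ Set.range e →
        SameT L' (f ∘ u) (f ∘ v) := by
  induction l with
  | nil =>
    intro H hH
    obtain ⟨e⟩ := hH.2
    exact ⟨e, by simp⟩
  | cons P l ih =>
    intro H hH
    obtain ⟨hP, hPfin⟩ := hl P (by simp)
    obtain ⟨k, c, hc⟩ := finite_coloring (L := L') homega P
    have hk : 1 ≤ k := by
      have := (c (fun _ => Classical.arbitrary Ω)).2
      omega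
    obtain ⟨S, hS, hmono⟩ := hram k hk H hH P hP
    obtain ⟨eS, heS⟩ := ih (fun Q hQ => hl Q (by simp [hQ])) S hS
    let emb : ∀ Q : {Q : L.Substructure S // Nonempty (P ≃[L] Q)}, P ↪[L] X := fun Q =>
      (eS.comp Q.1.subtype).comp Q.2.some.toEmbedding
    obtain ⟨e, he⟩ := hmono (fun Q => c (f ∘ emb Q))
    have hrange : Set.range (eS.comp e) ⊆ Set.range eS := by
      rintro _ ⟨x, rfl⟩
      exact ⟨e x, rfl⟩
    refine ⟨eS.comp e, fun Q hQ u v hu hv => ?_⟩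
    rcases List.mem_cons.1 hQ with rfl | hQ
    · have key : ∀ w : Q ↪[L] X, Set.range w ⊆ Set.range (eS.comp e) →
          ∃ R : {R : L.Substructure S // Nonempty (Q ≃[L] R)},
            (R.1 : Set S) ⊆ Set.range e ∧ (emb R : Q → X) = w := by
        intro w hw
        obtain ⟨w', hw'⟩ := factor hrel w eS (hw.trans hrange)
        refine ⟨⟨w'.toHom.range, ⟨w'.equivRange⟩⟩, ?_, ?_⟩
        · rintro _ ⟨p, rfl⟩
          obtain ⟨x, hx⟩ := hw ⟨p, rfl⟩
          refine ⟨x, eS.injective ?_⟩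
          exact hx.trans (hw' p).symm
        · apply rigid hord
          ext x
          constructor
          · rintro ⟨p, rfl⟩
            obtain ⟨q, hq⟩ := ((⟨w'.equivRange⟩ : Nonempty (Q ≃[L] w'.toHom.range)).some p).2
            refine ⟨q, ?_⟩
            rw [← hw']
            exact congrArg eS hq
          · rintro ⟨p, rfl⟩
            obtain ⟨q, hq⟩ := ((⟨w'.equivRange⟩ : Nonempty (Q ≃[L] w'.toHom.range)).some).surjective
              (w'.equivRange p)
            refine ⟨q, ?_⟩
            rw [← hw']
            exact congrArg (fun z : w'.toHom.range => eS z.1) hq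
      obtain ⟨R₁, h1, h1'⟩ := key u hu
      obtain ⟨R₂, h2, h2'⟩ := key v hv
      have := hc _ _ (he R₁ R₂ h1 h2)
      rwa [h1', h2'] at this
    · exact heS Q hQ u v (hu.trans hrange) (hv.trans hrange)

end Ramsey
end PaperDef

namespace PaperDef
/-- **Lemma 5 of the paper.**  Let `Ξ` (an `L`-structure on `X`) be countably infinite,
ordered and Ramsey with relational signature, let `Ω` be a countably infinite ω-categorical
structure with countable signature, and let `f : X → Ω` be any function.  Then every finite
induced substructure `F` of `Ξ` has an isomorphic copy `F'` in `Ξ` on which `f` is canonical. -/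
theorem canonical_on_a_copy_of_every_finite_substructure
    (L L' : Language) (X Ω : Type) [L.Structure X] [L'.Structure Ω]
    [Countable X] [Infinite X] [Countable Ω] [Infinite Ω]
    (hrel : ∀ i, IsEmpty (L.Functions i))
    (hord : Ordered L X) (hram : RamseyClass (L.age X))
    (hcntF : Countable (Σ i, L'.Functions i)) (hcntR : Countable (Σ i, L'.Relations i))
    (homega : OmegaCategorical L' Ω) (f : X → Ω) :
    ∀ F : L.Substructure X, (F : Set X).Finite →
      ∃ F' : L.Substructure X, Nonempty (F ≃[L] F') ∧ CanonicalOn L L' X Ω (F' : Set X) f := by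
  classical
  intro F hF
  have hsym : Countable L'.Symbols := by
    unfold Language.Symbols
    infer_instance
  have hFfin : Finite F := hF
  have hsub : Finite (L.Substructure F) :=
    Finite.of_injective (fun P : L.Substructure F => (P : Set F)) SetLike.coe_injective
  have := Fintype.ofFinite (L.Substructure F)
  let bun : L.Substructure F → CategoryTheory.Bundled.{0} L.Structure := fun P => ⟨P, inferInstance⟩
  have hPfin : ∀ P : L.Substructure F, Finite P := fun P => inferInstance
  obtain ⟨e, he⟩ := ramsey_list hrel hord hram homega f
    ((Finset.univ : Finset (L.Substructure F)).toList.map bun) (by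
      intro P hP
      obtain ⟨Q, _, rfl⟩ := List.mem_map.1 hP
      exact ⟨⟨Structure.FG.of_finite (M := Q), ⟨F.subtype.comp Q.subtype⟩⟩, hPfin Q⟩)
    ⟨F, inferInstance⟩ ⟨Structure.FG.of_finite (M := F), ⟨F.subtype⟩⟩
  change F ↪[L] X at e
  refine ⟨e.toHom.range, ⟨e.equivRange⟩, ?_⟩
  intro n a b ha hb hab
  have ha' : ∀ i, ∃ x : F, e x = a i := ha
  choose a' ha' using ha'
  let P : L.Substructure F := ⟨Set.range a', fun {m} g => ((hrel m).false g).elim⟩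
  have hP : ∀ p : P, ∃ i, a' i = p.1 := fun p => p.2
  choose idx hidx using hP
  have heq : ∀ i j, a i = a j ↔ b i = b j := by
    intro i j
    have := hab ((Term.var i).equal (Term.var j))
    simpa [Formula.realize_equal] using this
  let u : P ↪[L] X := e.comp P.subtype
  have hu : ∀ p, u p = a (idx p) := by
    intro p
    rw [← ha', hidx]
    rfl
  let v : P ↪[L] X := ⟨⟨fun p => b (idx p), fun p q hpq => u.injective (by
      rw [hu, hu]; exact (heq _ _).2 hpq)⟩,
    fun {m} g => ((hrel m).false g).elim, fun {m} r x => by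
      have h1 := hab (r.formula (fun j => Term.var (idx (x j))))
      rw [Formula.realize_rel, Formula.realize_rel] at h1
      rw [← u.map_rel]
      have h2 : (u ∘ x : Fin m → X) = fun j => a (idx (x j)) := by
        funext j; exact hu _
      rw [h2]
      exact h1.symm⟩
  have hsame := he (bun P) (List.mem_map.2 ⟨P, by simp, rfl⟩) u v (by
      rintro _ ⟨p, rfl⟩; exact ⟨p.1, rfl⟩) (by
      rintro _ ⟨p, rfl⟩; exact hb (idx p))
  have hfin := hsame.comp (fun i : Fin n => (⟨a' i, i, rfl⟩ : P))
  have h1 : ∀ i, u ⟨a' i, i, rfl⟩ = a i := fun i => ha' i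
  have h2 : ∀ i, v ⟨a' i, i, rfl⟩ = b i := by
    intro i
    change b (idx _) = b i
    rw [← heq, ← hu]
    exact h1 i
  intro φ
  have h3 := hfin φ
  have e1 : (f ∘ u) ∘ (fun i : Fin n => (⟨a' i, i, rfl⟩ : P)) = fun i => f (a i) := by
    funext i; exact congrArg f (h1 i)
  have e2 : (f ∘ v) ∘ (fun i : Fin n => (⟨a' i, i, rfl⟩ : P)) = fun i => f (b i) := by
    funext i; exact congrArg f (h2 i)
  rw [← e1, ← e2]
  exact h3

end PaperDef
end
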